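/- arXiv:1309.2700 — 4 statements merged into one kernel-verified Lean document; each statement's English description precedes it below -/
import Mathlib

section
/- Fix an integer N ≥ 2 and a real ρ > 0, and let A be the N×N tridiagonal matrix defined below. Then all eigenvalues of A (over ℂ) are real, they are pairwise distinct, and every eigenvalue is strictly negative; i.e. A has exactly N distinct real eigenvalues −ν_0 > −ν_1 > ⋯ > −ν_{N−1} with 0 < ν_0 < ν_1 < ⋯ < ν_{N−1}. -/
/-- The `N × N` tridiagonal transition matrix of the finite population
processor-sharing queue: `A(n,n) = -1 - ρ(N-n-1)/N`, `A(n,n+1) = ρ(N-n-1)/N`,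
`A(n,n-1) = n/(n+1)`, all other entries zero. -/
noncomputable def psMatrix (N : ℕ) (ρ : ℝ) : Matrix (Fin N) (Fin N) ℝ :=
  Matrix.of fun n m =>
    if (m : ℕ) = (n : ℕ) then -1 - ρ * ((N : ℝ) - (n : ℕ) - 1) / N
    else if (m : ℕ) = (n : ℕ) + 1 then ρ * ((N : ℝ) - (n : ℕ) - 1) / N
    else if (m : ℕ) + 1 = (n : ℕ) then (n : ℝ) / ((n : ℝ) + 1)
    else 0

/-- Eigenvectors of an unreduced lower Hessenberg matrix with vanishing zeroth entry vanish. -/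
theorem ps_hess_zero {N : ℕ} (S : Matrix (Fin N) (Fin N) ℂ)
    (h0 : ∀ i j : Fin N, (i : ℕ) + 1 < j → S i j = 0)
    (h1 : ∀ i j : Fin N, (i : ℕ) + 1 = j → S i j ≠ 0)
    (v : Fin N → ℂ) (l : ℂ) (hv : ∀ i, ∑ j, S i j * v j = l * v i)
    (hz : ∀ i : Fin N, (i : ℕ) = 0 → v i = 0) : v = 0 := by
  have key : ∀ n : ℕ, ∀ i : Fin N, (i : ℕ) = n → v i = 0 := by
    intro n
    induction n using Nat.strong_induction_on with
    | _ n ih =>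
      intro i hi
      rcases Nat.eq_zero_or_pos n with h | h
      · exact hz i (by omega)
      · have hk : n - 1 < N := by have := i.2; omega
        have hr := hv ⟨n - 1, hk⟩
        rw [ih (n - 1) (by omega) ⟨n - 1, hk⟩ rfl, mul_zero,
          Finset.sum_eq_single i] at hr
        · rcases mul_eq_zero.mp hr with h' | h'
          · exact absurd h' (h1 _ _ (by simp only; omega))
          · exact h'
        · intro j _ hj
          have hj' : (j : ℕ) ≠ i := fun h => hj (Fin.ext h)
          rcases lt_or_ge (j : ℕ) n with h2 | h2
          · rw [ih j h2 j rfl, mul_zero]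
          · rw [h0 _ _ (by simp only; omega), zero_mul]
        · simp
  funext i
  exact key i i rfl

theorem ps_hess_inj {N : ℕ} (hN : 0 < N) (S : Matrix (Fin N) (Fin N) ℂ) (hS : S.IsHermitian)
    (h0 : ∀ i j : Fin N, (i : ℕ) + 1 < j → S i j = 0)
    (h1 : ∀ i j : Fin N, (i : ℕ) + 1 = j → S i j ≠ 0) :
    Function.Injective hS.eigenvalues := by
  intro i j hij
  by_contra hne
  have hrow : ∀ k n, ∑ m, S n m * (hS.eigenvectorBasis k) m =
      (hS.eigenvalues k : ℂ) * (hS.eigenvectorBasis k) n := by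
    intro k n
    have := congrFun (hS.mulVec_eigenvectorBasis k) n
    simpa [Matrix.mulVec, dotProduct] using this
  set u := hS.eigenvectorBasis i with hu
  set w := hS.eigenvectorBasis j with hw
  set z : Fin N := ⟨0, hN⟩
  have hv := ps_hess_zero S h0 h1 (fun n => w z * u n - u z * w n) (hS.eigenvalues i)
    (by
      intro n
      have e1 := hrow i n
      have e2 := hrow j n
      rw [← hij] at e2
      calc _ = w z * (∑ m, S n m * u m) - u z * ∑ m, S n m * w m := by
            rw [Finset.mul_sum, Finset.mul_sum, ← Finset.sum_sub_distrib]
            exact Finset.sum_congr rfl fun m _ => by ring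
        _ = _ := by rw [e1, e2]; ring)
    (by
      intro n hn
      have : n = z := Fin.ext hn
      subst this
      ring)
  have hv' : w z • u - u z • w = 0 := by
    ext n
    simpa using congrFun hv n
  have hin : inner ℂ w (w z • u - u z • w) = 0 := by rw [hv', inner_zero_right]
  have o := hS.eigenvectorBasis.orthonormal
  have o1 : inner ℂ w u = 0 := o.2 (Ne.symm hne)
  have o2 : ‖w‖ = 1 := o.1 j
  rw [inner_sub_right, inner_smul_right, inner_smul_right, o1, inner_self_eq_norm_sq_to_K, o2] at hin
  have huz : u z = 0 := by simpa using hin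
  have hu0 := ps_hess_zero S h0 h1 u (hS.eigenvalues i) (hrow i)
    (by
      intro n hn
      have : n = z := Fin.ext hn
      subst this
      exact huz)
  have : ‖u‖ = 1 := o.1 i
  have hu1 : u = 0 := by
    ext n
    exact congrFun hu0 n
  rw [hu1] at this
  simp at this

theorem ps_sum_le {N : ℕ} (c : ℝ) (hc : 0 ≤ c) (p : Fin N → Prop) [DecidablePred p]
    (hp : ∀ i j, p i → p j → i = j) : ∑ j, (if p j then c else 0) ≤ c := by
  by_cases h : ∃ i, p i
  · obtain ⟨i, hi⟩ := h
    rw [Finset.sum_eq_single i]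
    · simp [hi]
    · intro j _ hj
      rw [if_neg]
      exact fun h => hj (hp _ _ h hi)
    · simp
  · push Not at h
    simp [h, hc]

theorem ps_neg (N : ℕ) (ρ : ℝ) (hρ : 0 < ρ) (μ : ℝ)
    (h : (μ : ℂ) ∈ spectrum ℂ ((psMatrix N ρ).map (fun x : ℝ => (x : ℂ)))) : μ < 0 := by
  rw [← Matrix.spectrum_toLin'] at h
  obtain ⟨k, hk⟩ := eigenvalue_mem_ball (Module.End.HasEigenvalue.of_mem_spectrum h)
  rw [Metric.mem_closedBall, dist_eq_norm] at hk
  simp only [Matrix.map_apply, ← Complex.ofReal_sub, Complex.norm_real, Real.norm_eq_abs] at hk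
  have hkN : (k : ℝ) + 1 ≤ N := by exact_mod_cast k.2
  have hk0 : (0 : ℝ) ≤ k := Nat.cast_nonneg _
  have hb : 0 ≤ ρ * ((N : ℝ) - (k : ℕ) - 1) / N :=
    div_nonneg (mul_nonneg hρ.le (by linarith)) (by linarith)
  have hc : 0 ≤ (k : ℝ) / ((k : ℝ) + 1) := by positivity
  have hc1 : (k : ℝ) / ((k : ℝ) + 1) < 1 := by
    rw [div_lt_one (by linarith)]; linarith
  have hsum : ∑ j ∈ Finset.univ.erase k, |psMatrix N ρ k j| ≤
      ρ * ((N : ℝ) - (k : ℕ) - 1) / N + (k : ℝ) / ((k : ℝ) + 1) := by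
    calc _ ≤ ∑ j ∈ Finset.univ.erase k,
          ((if (j : ℕ) = k + 1 then ρ * ((N : ℝ) - (k : ℕ) - 1) / N else 0)
            + (if (j : ℕ) + 1 = k then (k : ℝ) / ((k : ℝ) + 1) else 0)) := by
          refine Finset.sum_le_sum fun j hj => ?_
          have hj' : (j : ℕ) ≠ k := fun h => (Finset.ne_of_mem_erase hj) (Fin.ext h)
          simp only [psMatrix, Matrix.of_apply, if_neg hj']
          split_ifs with h1 h2
          · omega
          · rw [abs_of_nonneg hb]; simp
          · rw [abs_of_nonneg hc]; simp
          · simp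
      _ ≤ ∑ j : Fin N, ((if (j : ℕ) = k + 1 then ρ * ((N : ℝ) - (k : ℕ) - 1) / N else 0)
            + (if (j : ℕ) + 1 = k then (k : ℝ) / ((k : ℝ) + 1) else 0)) := by
          refine Finset.sum_le_sum_of_subset_of_nonneg (Finset.erase_subset _ _) ?_
          intro j _ _
          refine add_nonneg ?_ ?_ <;> split_ifs <;> first | assumption | exact le_rfl
      _ ≤ _ := by
          rw [Finset.sum_add_distrib]
          refine add_le_add (ps_sum_le _ hb _ ?_) (ps_sum_le _ hc _ ?_)
          · intro a b ha hb
            exact Fin.ext (by omega)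
          · intro a b ha hb
            exact Fin.ext (by omega)
  have hd : psMatrix N ρ k k = -1 - ρ * ((N : ℝ) - (k : ℕ) - 1) / N := by
    simp [psMatrix]
  have := (le_abs_self _).trans (hk.trans hsum)
  rw [hd] at this
  linarith

/-- Squares of the symmetrizing weights. -/
noncomputable def psW (N : ℕ) (ρ : ℝ) : ℕ → ℝ
  | 0 => 1
  | n + 1 => psW N ρ n * (ρ * ((N : ℝ) - n - 1) / N) / (((n : ℝ) + 1) / ((n : ℝ) + 1 + 1))

theorem ps_b_pos (N : ℕ) (ρ : ℝ) (hρ : 0 < ρ) (n : ℕ) (hn : n + 1 < N) :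
    0 < ρ * ((N : ℝ) - n - 1) / N := by
  have : (n : ℝ) + 1 < N := by exact_mod_cast hn
  have h0 : (0 : ℝ) ≤ n := Nat.cast_nonneg _
  exact div_pos (mul_pos hρ (by linarith)) (by linarith)

theorem psW_pos (N : ℕ) (ρ : ℝ) (hρ : 0 < ρ) (n : ℕ) (hn : n < N) : 0 < psW N ρ n := by
  induction n with
  | zero => simp [psW]
  | succ n ih =>
    have := ps_b_pos N ρ hρ n hn
    have := ih (by omega)
    rw [psW]
    positivity

theorem ps_balance (N : ℕ) (ρ : ℝ) (i j : Fin N) (hij : (i : ℕ) + 1 = j) :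
    psW N ρ i * psMatrix N ρ i j = psW N ρ j * psMatrix N ρ j i := by
  have e1 : psMatrix N ρ i j = ρ * ((N : ℝ) - (i : ℕ) - 1) / N := by
    simp only [psMatrix, Matrix.of_apply]
    rw [if_neg (by omega), if_pos (by omega)]
  have e2 : psMatrix N ρ j i = ((i : ℝ) + 1) / ((i : ℝ) + 1 + 1) := by
    simp only [psMatrix, Matrix.of_apply]
    rw [if_neg (by omega), if_neg (by omega), if_pos (by omega), ← hij]
    push_cast
    rfl
  rw [e1, e2, ← hij, psW, div_mul_cancel₀]
  positivity

theorem ps_symm (N : ℕ) (ρ : ℝ) (i j : Fin N) :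
    psW N ρ i * psMatrix N ρ i j = psW N ρ j * psMatrix N ρ j i := by
  by_cases h1 : (i : ℕ) + 1 = j
  · exact ps_balance N ρ i j h1
  by_cases h2 : (j : ℕ) + 1 = i
  · exact (ps_balance N ρ j i h2).symm
  by_cases h3 : i = j
  · rw [h3]
  · have h3' : (i : ℕ) ≠ j := fun h => h3 (Fin.ext h)
    simp only [psMatrix, Matrix.of_apply]
    rw [if_neg (by omega), if_neg (by omega), if_neg (by omega), if_neg (by omega),
      if_neg (by omega), if_neg (by omega)]
    simp

/-- all complex eigenvalues of `A` are real, pairwise distinct and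
strictly negative: there are `ν 0 < ν 1 < ⋯ < ν (N-1)`, all positive, such that the
spectrum of `A` over `ℂ` is exactly `{-ν j : j}`. -/
theorem ps_eigenvalues_real_distinct_negative (N : ℕ) (hN : 2 ≤ N) (ρ : ℝ) (hρ : 0 < ρ) :
    ∃ ν : Fin N → ℝ, StrictMono ν ∧ (∀ j, 0 < ν j) ∧
      spectrum ℂ ((psMatrix N ρ).map (fun x : ℝ => (x : ℂ))) =
        Set.range (fun j : Fin N => (-(ν j) : ℂ)) := by
  set M := (psMatrix N ρ).map (fun x : ℝ => (x : ℂ)) with hM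
  let d : Fin N → ℝ := fun i => Real.sqrt (psW N ρ i)
  have hd : ∀ i, 0 < d i := fun i => Real.sqrt_pos.mpr (psW_pos N ρ hρ i i.2)
  have hd2 : ∀ i, d i * d i = psW N ρ i := fun i => Real.mul_self_sqrt (psW_pos N ρ hρ i i.2).le
  have hdc : ∀ i, (d i : ℂ) ≠ 0 := fun i => by exact_mod_cast (hd i).ne'
  let S : Matrix (Fin N) (Fin N) ℂ :=
    Matrix.of fun i j => ((d i * psMatrix N ρ i j * (d j)⁻¹ : ℝ) : ℂ)
  have hSM : spectrum ℂ S = spectrum ℂ M := by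
    let u : (Matrix (Fin N) (Fin N) ℂ)ˣ :=
      ⟨Matrix.diagonal fun i => (d i : ℂ), Matrix.diagonal fun i => (d i : ℂ)⁻¹,
        by rw [Matrix.diagonal_mul_diagonal]; simp [hdc],
        by rw [Matrix.diagonal_mul_diagonal]; simp [hdc]⟩
    have : S = u * M * (u⁻¹ : (Matrix (Fin N) (Fin N) ℂ)ˣ) := by
      have e1 : (u : Matrix (Fin N) (Fin N) ℂ) = Matrix.diagonal fun i => (d i : ℂ) := rfl
      have e2 : ((u⁻¹ : (Matrix (Fin N) (Fin N) ℂ)ˣ) : Matrix (Fin N) (Fin N) ℂ) =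
        Matrix.diagonal fun i => (d i : ℂ)⁻¹ := rfl
      rw [e1, e2]
      ext i j
      rw [Matrix.mul_diagonal, Matrix.diagonal_mul]
      simp [S, hM]
    rw [this, spectrum.units_conjugate]
  have hS : S.IsHermitian := by
    refine Matrix.IsHermitian.ext fun i j => ?_
    simp only [S, Matrix.of_apply, RCLike.star_def, Complex.conj_ofReal]
    congr 1
    have := ps_symm N ρ i j
    rw [← hd2, ← hd2] at this
    have h1 := (hd i).ne'
    have h2 := (hd j).ne'
    field_simp
    linarith
  have hinj : Function.Injective hS.eigenvalues := by
    refine ps_hess_inj (by omega) S hS ?_ ?_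
    · intro i j hij
      have : psMatrix N ρ i j = 0 := by
        simp only [psMatrix, Matrix.of_apply]
        rw [if_neg (by omega), if_neg (by omega), if_neg (by omega)]
      simp [S, this]
    · intro i j hij
      have : psMatrix N ρ i j ≠ 0 := by
        simp only [psMatrix, Matrix.of_apply]
        rw [if_neg (by omega), if_pos (by omega)]
        exact (ps_b_pos N ρ hρ i (by have := j.2; omega)).ne'
      simp only [S, Matrix.of_apply]
      exact_mod_cast mul_ne_zero (mul_ne_zero (hd i).ne' this) (inv_ne_zero (hd j).ne')
  have hspec : spectrum ℂ M = (fun x : ℝ => (x : ℂ)) '' Set.range hS.eigenvalues := by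
    rw [← hSM]; exact hS.spectrum_eq_image_range
  let s : Finset ℝ := Finset.univ.image fun i => -hS.eigenvalues i
  have hs : s.card = N := by
    rw [Finset.card_image_of_injective _ (fun a b h => hinj (neg_injective h))]
    simp
  have hrange : Set.range (s.orderEmbOfFin hs) = s := Finset.range_orderEmbOfFin s hs
  refine ⟨s.orderEmbOfFin hs, (s.orderEmbOfFin hs).strictMono, ?_, ?_⟩
  · intro j
    have hj : s.orderEmbOfFin hs j ∈ s := Finset.orderEmbOfFin_mem s hs j
    obtain ⟨i, -, hi⟩ := Finset.mem_image.mp hj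
    rw [← hi, neg_pos]
    refine ps_neg N ρ hρ _ ?_
    rw [← hM, hspec]
    exact ⟨_, ⟨i, rfl⟩, rfl⟩
  · have : Set.range (fun j : Fin N => (-(s.orderEmbOfFin hs j) : ℂ)) =
        (fun x : ℝ => (-x : ℂ)) '' Set.range (s.orderEmbOfFin hs) := by
      rw [← Set.range_comp]; rfl
    rw [this, hrange, hspec]
    simp [s, ← Set.range_comp, Set.image_image, Function.comp_def]
end

section
/- Fix 0 < ρ < 1 and let τ₀, τ* be defined below. For ξ > 0 and τ > 0 define B(ξ,τ) = [e^{2ρτ} − 1 − ρξe^{ρτ} − √((ρξe^{ρτ} + 1 − e^{2ρτ})² − 4e^{ρτ}(e^{ρτ}−1)((1−ρ)(e^{ρτ}−1) − ρξ))] / (2(e^{ρτ}−1)). Then for every ξ > 0 and every τ with τ₀(ξ) < τ < τ*(ξ): the quantity under the square root is strictly positive (so B is well defined and real), and 0 < B(ξ,τ) < 1 − √ρ. Moreover B(ξ, τ₀(ξ)) = 0 and B(ξ, τ*(ξ)) = 1 − √ρ. -/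
/-- The curve `τ₀(ξ) = (1/ρ) log(1 + ρξ/(1-ρ))`. -/
noncomputable def psTau0 (ρ ξ : ℝ) : ℝ := (1 / ρ) * Real.log (1 + ρ * ξ / (1 - ρ))

/-- The curve `τ*(ξ) = (1/ρ) log(1 + (ρξ + √(ρ²ξ² + 4ρξ(1-√ρ)))/(2(1-√ρ)))`. -/
noncomputable def psTauStar (ρ ξ : ℝ) : ℝ :=
  (1 / ρ) * Real.log (1 +
    (ρ * ξ + Real.sqrt (ρ ^ 2 * ξ ^ 2 + 4 * ρ * ξ * (1 - Real.sqrt ρ))) /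
      (2 * (1 - Real.sqrt ρ)))

/-- The discriminant under the square root in the definition of the ray
parameter `B(ξ,τ)`. -/
noncomputable def psBdisc (ρ ξ τ : ℝ) : ℝ :=
  (ρ * ξ * Real.exp (ρ * τ) + 1 - Real.exp (2 * ρ * τ)) ^ 2 -
    4 * Real.exp (ρ * τ) * (Real.exp (ρ * τ) - 1) *
      ((1 - ρ) * (Real.exp (ρ * τ) - 1) - ρ * ξ)

/-- The ray parameter `B(ξ,τ)` in region `R₂`. -/
noncomputable def psB (ρ ξ τ : ℝ) : ℝ :=
  (Real.exp (2 * ρ * τ) - 1 - ρ * ξ * Real.exp (ρ * τ) - Real.sqrt (psBdisc ρ ξ τ)) /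
    (2 * (Real.exp (ρ * τ) - 1))

lemma psB_exp_tau (ρ y : ℝ) (h0 : 0 < ρ) (hy : 0 < y) :
    Real.exp (ρ * ((1 / ρ) * Real.log y)) = y := by
  rw [← mul_assoc, mul_one_div_cancel h0.ne', one_mul, Real.exp_log hy]

lemma psB_lt_exp (ρ y τ : ℝ) (h0 : 0 < ρ) (hy : 0 < y) (h : (1 / ρ) * Real.log y < τ) :
    y < Real.exp (ρ * τ) := by
  rw [← psB_exp_tau ρ y h0 hy]
  exact Real.exp_lt_exp.mpr (mul_lt_mul_of_pos_left h h0)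

lemma psB_exp_lt (ρ y τ : ℝ) (h0 : 0 < ρ) (hy : 0 < y) (h : τ < (1 / ρ) * Real.log y) :
    Real.exp (ρ * τ) < y := by
  rw [← psB_exp_tau ρ y h0 hy]
  exact Real.exp_lt_exp.mpr (mul_lt_mul_of_pos_left h h0)

lemma psB_exp_two (ρ τ : ℝ) : Real.exp (2 * ρ * τ) = Real.exp (ρ * τ) ^ 2 := by
  rw [← Real.exp_nat_mul]; congr 1; push_cast; ring

/-- in region `R₂` (i.e. `ξ > 0`, `τ₀(ξ) < τ < τ*(ξ)`) the
discriminant is positive and `0 < B(ξ,τ) < 1 - √ρ`; moreover `B(ξ,τ₀(ξ)) = 0`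
and `B(ξ,τ*(ξ)) = 1 - √ρ`. -/
theorem psB_region_R2 (ρ : ℝ) (h0 : 0 < ρ) (h1 : ρ < 1) :
    (∀ ξ : ℝ, 0 < ξ → ∀ τ : ℝ, psTau0 ρ ξ < τ → τ < psTauStar ρ ξ →
      0 < psBdisc ρ ξ τ ∧ 0 < psB ρ ξ τ ∧ psB ρ ξ τ < 1 - Real.sqrt ρ) ∧
    (∀ ξ : ℝ, 0 < ξ →
      psB ρ ξ (psTau0 ρ ξ) = 0 ∧ psB ρ ξ (psTauStar ρ ξ) = 1 - Real.sqrt ρ) := by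
  set s := Real.sqrt ρ with hs
  have hs0 : 0 < s := Real.sqrt_pos.mpr h0
  have hss : s ^ 2 = ρ := Real.sq_sqrt h0.le
  have hs1 : s < 1 := by nlinarith
  have hb : 0 < 1 - s := by linarith
  have hr : 0 < 1 - ρ := by linarith
  have key : ∀ ξ : ℝ, 0 < ξ → ∃ w : ℝ, 0 < w ∧ (1 - s) * w ^ 2 = ρ * ξ * w + ρ * ξ ∧
      psTauStar ρ ξ = (1 / ρ) * Real.log (1 + w) := by
    intro ξ hξ
    have hx : 0 < ρ * ξ := mul_pos h0 hξ
    have hd : 0 ≤ ρ ^ 2 * ξ ^ 2 + 4 * ρ * ξ * (1 - s) := by positivity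
    refine ⟨(ρ * ξ + Real.sqrt (ρ ^ 2 * ξ ^ 2 + 4 * ρ * ξ * (1 - s))) / (2 * (1 - s)),
      by positivity, ?_, rfl⟩
    have hq := Real.sq_sqrt hd
    set q := Real.sqrt (ρ ^ 2 * ξ ^ 2 + 4 * ρ * ξ * (1 - s))
    have hb' := hb.ne'
    generalize 1 - s = b at *
    field_simp
    linear_combination hq
  have hρ : 1 - ρ = (1 - s) * (1 + s) := by rw [← hss]; ring
  refine ⟨?_, ?_⟩
  · intro ξ hξ τ ht0 ht1
    have hx : 0 < ρ * ξ := mul_pos h0 hξ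
    obtain ⟨w, hw, hwe, hws⟩ := key ξ hξ
    rw [hws] at ht1
    have e1 := psB_lt_exp ρ _ τ h0 (by positivity) ht0
    have e2 := psB_exp_lt ρ _ τ h0 (by positivity) ht1
    unfold psB psBdisc
    rw [psB_exp_two]
    obtain ⟨u, hu⟩ : ∃ u, Real.exp (ρ * τ) = u + 1 := ⟨Real.exp (ρ * τ) - 1, by ring⟩
    rw [hu] at e1 e2 ⊢
    generalize ρ * ξ = x at *
    have hd0 : 0 < x / (1 - ρ) := by positivity
    have hu0 : 0 < u := by linarith
    have hQ0 : 0 < (1 - ρ) * u - x := by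
      have : x / (1 - ρ) < u := by linarith
      rw [div_lt_iff₀ hr] at this
      linarith
    have hQb : (1 - s) * u ^ 2 - x * u - x < 0 := by
      have huw : u < w := by linarith
      have h3 : x < (1 - s) * w ^ 2 - x * w + 1 * x := by linarith
      have h4 : 0 < (1 - s) * w - x := by
        by_contra hcon
        nlinarith
      by_contra hcon
      nlinarith [mul_pos hb (mul_pos hu0 (sub_pos.mpr huw)), mul_pos (sub_pos.mpr huw) h4]
    obtain ⟨P, hP⟩ : ∃ P, P = (u + 1) ^ 2 - 1 - x * (u + 1) := ⟨_, rfl⟩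
    have hQ : u * (1 - s) ^ 2 - P * (1 - s) + (u + 1) * ((1 - ρ) * u - x)
        = s * ((1 - s) * u ^ 2 - x * u - x) := by
      rw [hP, hρ]; ring
    have hQneg : u * (1 - s) ^ 2 - P * (1 - s) + (u + 1) * ((1 - ρ) * u - x) < 0 := by
      rw [hQ]; exact mul_neg_of_pos_of_neg hs0 hQb
    have hQ0' : 0 < (u + 1) * ((1 - ρ) * u - x) := by positivity
    have hPpos : 0 < P := by
      have : 0 < P * (1 - s) := by nlinarith [mul_pos hu0 (pow_pos hb 2)]
      exact (mul_pos_iff_of_pos_right hb).mp this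
    obtain ⟨D, hD⟩ : ∃ D, D = (x * (u + 1) + 1 - (u + 1) ^ 2) ^ 2 -
      4 * (u + 1) * (u + 1 - 1) * ((1 - ρ) * (u + 1 - 1) - x) := ⟨_, rfl⟩
    have hD' : D = P ^ 2 - 4 * u * ((u + 1) * ((1 - ρ) * u - x)) := by
      rw [hD, hP]; ring
    rw [← hD, ← hP]
    have hDlo : (P - 2 * u * (1 - s)) ^ 2 < D := by
      nlinarith [mul_pos hu0 (neg_pos.mpr hQneg)]
    have hDhi : D < P ^ 2 := by nlinarith [mul_pos hu0 hQ0']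
    have hu2 : 0 < 2 * (u + 1 - 1) := by linarith
    refine ⟨lt_of_le_of_lt (sq_nonneg _) hDlo, ?_, ?_⟩
    · apply div_pos _ hu2
      have := (Real.sqrt_lt' hPpos).mpr hDhi
      linarith
    · rw [div_lt_iff₀ hu2]
      have := Real.lt_sqrt_of_sq_lt hDlo
      linarith
  · intro ξ hξ
    have hx : 0 < ρ * ξ := mul_pos h0 hξ
    constructor
    · have e1 : Real.exp (ρ * psTau0 ρ ξ) = 1 + ρ * ξ / (1 - ρ) :=
        psB_exp_tau ρ _ h0 (by positivity)
      unfold psB psBdisc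
      rw [psB_exp_two, e1]
      obtain ⟨u, hu⟩ : ∃ u, u = ρ * ξ / (1 - ρ) := ⟨_, rfl⟩
      have hu0 : 0 < u := by rw [hu]; positivity
      have hxu : ρ * ξ = (1 - ρ) * u := by rw [hu]; field_simp
      rw [← hu, hxu]
      have hP : 0 ≤ u * (1 + ρ * (u + 1)) := by positivity
      rw [show ((1 - ρ) * u * (1 + u) + 1 - (1 + u) ^ 2) ^ 2 - 4 * (1 + u) * (1 + u - 1) *
        ((1 - ρ) * (1 + u - 1) - (1 - ρ) * u) = (u * (1 + ρ * (u + 1))) ^ 2 by ring,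
        Real.sqrt_sq hP, div_eq_zero_iff]
      left; ring
    · obtain ⟨u, hu0, hue, hus⟩ := key ξ hξ
      have e1 : Real.exp (ρ * psTauStar ρ ξ) = 1 + u := by
        rw [hus]; exact psB_exp_tau ρ _ h0 (by positivity)
      unfold psB psBdisc
      rw [psB_exp_two, e1]
      generalize ρ * ξ = x at *
      have hP : 0 ≤ u * s * (u + 2) := by positivity
      have hDD : (x * (1 + u) + 1 - (1 + u) ^ 2) ^ 2 - 4 * (1 + u) * (1 + u - 1) *
        ((1 - ρ) * (1 + u - 1) - x) = (u * s * (u + 2)) ^ 2 := by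
        have hx1 : x * (1 + u) = (1 - s) * u ^ 2 := by linarith
        have : 4 * (1 + u) * (1 + u - 1) * ((1 - ρ) * (1 + u - 1) - x) =
          4 * u * ((1 + u) * (1 - ρ) * u - x * (1 + u)) := by ring
        rw [this, hx1, hρ]; ring
      rw [hDD, Real.sqrt_sq hP, div_eq_iff (by linarith)]
      linear_combination hue
end

section
/- Fix 0 < ρ < 1 and define 𝓗(Δ) = (1/√(2π)) · ∫_{−Δ}^{∞} (y + Δ)^{ρ/(1−ρ)} · exp(−(1−ρ)²y²/2) dy for Δ ∈ ℝ. Then the integral converges for every Δ ∈ ℝ, 𝓗 is twice differentiable on ℝ, and 𝓗 satisfies the second-order ODE 𝓗″(Δ) + (1−ρ)²·Δ·𝓗′(Δ) − ρ(1−ρ)·𝓗(Δ) = 0 for all Δ ∈ ℝ. -/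
open MeasureTheory

/-- The similarity solution `𝓗(Δ)` in the transition region `T₁`. -/
noncomputable def psH (ρ Δ : ℝ) : ℝ :=
  (1 / Real.sqrt (2 * Real.pi)) *
    ∫ y in Set.Ioi (-Δ),
      (y + Δ) ^ (ρ / (1 - ρ)) * Real.exp (-(1 - ρ) ^ 2 * y ^ 2 / 2)

open Filter Topology

/-- Shifted integrand. -/
noncomputable def psF (c p D z : ℝ) : ℝ := z ^ p * Real.exp (-c * (z - D) ^ 2 / 2)

lemma psF_meas (c p D : ℝ) : Measurable (psF c p D) := by
  unfold psF; fun_prop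

lemma psF_bound {c p D R z : ℝ} (hc : 0 < c) (hz : 0 < z) (hD : |D| ≤ R) :
    psF c p D z ≤ Real.exp (c * R ^ 2 / 2) * (z ^ p * Real.exp (-(c / 4) * z ^ 2)) := by
  have h2 : D ^ 2 ≤ R ^ 2 := by
    rw [← sq_abs D]; exact pow_le_pow_left₀ (abs_nonneg D) hD 2
  have h : Real.exp (-c * (z - D) ^ 2 / 2) ≤
      Real.exp (c * R ^ 2 / 2) * Real.exp (-(c / 4) * z ^ 2) := by
    rw [← Real.exp_add]
    apply Real.exp_le_exp.mpr
    have : 0 ≤ c * ((z - 2 * D) ^ 2 / 4 + (R ^ 2 - D ^ 2) / 2) :=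
      mul_nonneg hc.le (by nlinarith [sq_nonneg (z - 2 * D)])
    nlinarith
  have hp : 0 ≤ z ^ p := Real.rpow_nonneg hz.le p
  calc psF c p D z ≤ z ^ p * (Real.exp (c * R ^ 2 / 2) * Real.exp (-(c / 4) * z ^ 2)) :=
        mul_le_mul_of_nonneg_left h hp
    _ = _ := by ring

lemma psF_nonneg {c p D z : ℝ} (hz : 0 < z) : 0 ≤ psF c p D z :=
  mul_nonneg (Real.rpow_nonneg hz.le p) (Real.exp_pos _).le

lemma psF_int {c p : ℝ} (hc : 0 < c) (hp : -1 < p) (D : ℝ) :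
    IntegrableOn (psF c p D) (Set.Ioi 0) := by
  refine Integrable.mono' ((integrableOn_rpow_mul_exp_neg_mul_sq (b := c / 4) (by positivity)
    hp).const_mul (Real.exp (c * |D| ^ 2 / 2))) (psF_meas c p D).aestronglyMeasurable ?_
  filter_upwards [ae_restrict_mem measurableSet_Ioi] with z hz
  rw [Real.norm_of_nonneg (psF_nonneg hz)]
  exact psF_bound hc hz le_rfl

lemma psF_succ {c p D z : ℝ} (hz : 0 < z) : psF c (p + 1) D z = z * psF c p D z := by
  unfold psF; rw [Real.rpow_add_one hz.ne']; ring

/-- Integral. -/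
noncomputable def psI (c p D : ℝ) : ℝ := ∫ z in Set.Ioi 0, psF c p D z

lemma psI_deriv {c p : ℝ} (hc : 0 < c) (hp : -1 < p) (D : ℝ) :
    HasDerivAt (psI c p) (c * (psI c (p + 1) D - D * psI c p D)) D := by
  have key := hasDerivAt_integral_of_dominated_loc_of_deriv_le
    (μ := volume.restrict (Set.Ioi (0 : ℝ))) (F := fun D z => psF c p D z)
    (F' := fun D z => c * (z - D) * psF c p D z) (x₀ := D) (s := Metric.ball D 1)
    (bound := fun z => c * (Real.exp (c * (|D| + 1) ^ 2 / 2) *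
        (z ^ (p + 1) * Real.exp (-(c / 4) * z ^ 2)) + (|D| + 1) *
        (Real.exp (c * (|D| + 1) ^ 2 / 2) * (z ^ p * Real.exp (-(c / 4) * z ^ 2)))))
    (Metric.ball_mem_nhds D one_pos)
    (Eventually.of_forall fun x => (psF_meas c p x).aestronglyMeasurable)
    (psF_int hc hp D)
    (Measurable.aestronglyMeasurable (by have := psF_meas c p D; fun_prop))
    (by
      filter_upwards [ae_restrict_mem measurableSet_Ioi] with z hz x hx
      have hz : 0 < z := hz
      have hxR : |x| ≤ |D| + 1 := by
        rw [Metric.mem_ball, Real.dist_eq] at hx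
        have := abs_sub_abs_le_abs_sub x D
        linarith
      have b1 := psF_bound (p := p) hc hz hxR
      have b2 := psF_bound (p := p + 1) hc hz hxR
      have n := psF_nonneg (c := c) (p := p) (D := x) hz
      rw [psF_succ hz] at b2
      have hzx : |z - x| ≤ z + (|D| + 1) := by
        have := abs_sub z x
        rw [abs_of_pos hz] at this
        linarith
      rw [norm_mul, norm_mul, Real.norm_of_nonneg n, Real.norm_of_nonneg hc.le, Real.norm_eq_abs,
        mul_assoc]
      refine mul_le_mul_of_nonneg_left ?_ hc.le
      calc |z - x| * psF c p x z ≤ (z + (|D| + 1)) * psF c p x z :=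
            mul_le_mul_of_nonneg_right hzx n
        _ = z * psF c p x z + (|D| + 1) * psF c p x z := by ring
        _ ≤ _ := add_le_add b2 (mul_le_mul_of_nonneg_left b1 (by positivity)))
    ((((integrableOn_rpow_mul_exp_neg_mul_sq (b := c / 4) (by positivity)
      (by linarith : -1 < p + 1)).const_mul _).add
      (((integrableOn_rpow_mul_exp_neg_mul_sq (b := c / 4) (by positivity)
      hp).const_mul _).const_mul _)).const_mul _)
    (by
      refine Eventually.of_forall fun z x _ => ?_
      have h1 : HasDerivAt (fun x : ℝ => -c * (z - x) ^ 2 / 2) (c * (z - x)) x := by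
        have := (((((hasDerivAt_id x).const_sub z).pow 2).const_mul (-c)).div_const 2)
        refine this.congr_deriv ?_
        simp; ring
      refine (h1.exp.const_mul (z ^ p)).congr_deriv ?_
      unfold psF; ring)
  refine key.2.congr_deriv ?_
  have : ∫ z in Set.Ioi (0:ℝ), c * (z - D) * psF c p D z =
      ∫ z in Set.Ioi (0:ℝ), c * (psF c (p + 1) D z - D * psF c p D z) := by
    refine setIntegral_congr_fun measurableSet_Ioi fun z hz => ?_
    simp only [psF_succ hz]; ring
  rw [this, integral_const_mul, integral_sub (psF_int hc (by linarith) D)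
    ((psF_int hc hp D).const_mul _), integral_const_mul]
  rfl

lemma psI_rec {c p : ℝ} (hc : 0 < c) (hp : -1 < p) (D : ℝ) :
    c * (psI c (p + 1 + 1) D - D * psI c (p + 1) D) = (p + 1) * psI c p D := by
  have i0 := psF_int hc hp D
  have i1 := psF_int hc (by linarith : -1 < p + 1) D
  have i2 := psF_int hc (by linarith : -1 < p + 1 + 1) D
  have hd : ∀ z ∈ Set.Ioi (0:ℝ), HasDerivAt (psF c (p + 1) D)
      ((p + 1) * psF c p D z - c * (psF c (p + 1 + 1) D z - D * psF c (p + 1) D z)) z := by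
    intro z hz
    have hz : 0 < z := hz
    have h1 : HasDerivAt (fun z : ℝ => -c * (z - D) ^ 2 / 2) (-c * (z - D)) z := by
      have := (((((hasDerivAt_id z).sub_const D).pow 2).const_mul (-c)).div_const 2)
      refine this.congr_deriv ?_
      simp; ring
    have h2 := (Real.hasDerivAt_rpow_const (p := p + 1) (Or.inl hz.ne')).mul h1.exp
    refine h2.congr_deriv ?_
    rw [psF_succ (p := p + 1) hz]
    unfold psF
    rw [add_sub_cancel_right]; ring
  have i3 : IntegrableOn (fun z => c * (psF c (p + 1 + 1) D z - D * psF c (p + 1) D z))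
      (Set.Ioi 0) := (i2.sub (i1.const_mul D)).const_mul c
  have i' := (i0.const_mul (p + 1)).sub i3
  have ht := tendsto_zero_of_hasDerivAt_of_integrableOn_Ioi hd i' i1
  have hcont : ContinuousWithinAt (psF c (p + 1) D) (Set.Ici 0) 0 := by
    apply ContinuousAt.continuousWithinAt
    unfold psF
    exact (Real.continuousAt_rpow_const 0 (p + 1) (Or.inr (by linarith))).mul (by fun_prop)
  have e := integral_Ioi_of_hasDerivAt_of_tendsto hcont hd i' ht
  rw [integral_sub (i0.const_mul (p + 1)) i3,
    integral_const_mul, integral_const_mul, integral_sub i2 (i1.const_mul D),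
    integral_const_mul] at e
  have z0 : psF c (p + 1) D 0 = 0 := by
    unfold psF; rw [Real.zero_rpow (by linarith), zero_mul]
  rw [z0] at e
  unfold psI
  linarith

/-- for `0 < ρ < 1` the defining integral of `𝓗` converges for
every `Δ`, `𝓗` is twice differentiable, and it satisfies
`𝓗'' + (1-ρ)² Δ 𝓗' - ρ(1-ρ) 𝓗 = 0` on `ℝ`. -/
theorem psH_ODE (ρ : ℝ) (h0 : 0 < ρ) (h1 : ρ < 1) :
    (∀ Δ : ℝ, IntegrableOn
        (fun y => (y + Δ) ^ (ρ / (1 - ρ)) * Real.exp (-(1 - ρ) ^ 2 * y ^ 2 / 2))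
        (Set.Ioi (-Δ))) ∧
    (∀ Δ : ℝ, DifferentiableAt ℝ (psH ρ) Δ ∧
      DifferentiableAt ℝ (deriv (psH ρ)) Δ ∧
      deriv (deriv (psH ρ)) Δ + (1 - ρ) ^ 2 * Δ * deriv (psH ρ) Δ -
        ρ * (1 - ρ) * psH ρ Δ = 0) := by
  have hr : 0 < 1 - ρ := by linarith
  have hc : 0 < (1 - ρ) ^ 2 := by positivity
  have ha : -1 < ρ / (1 - ρ) := by have : 0 < ρ / (1 - ρ) := by positivity
                                   linarith
  have hpre : ∀ D : ℝ, (fun y : ℝ => y + D) ⁻¹' Set.Ioi 0 = Set.Ioi (-D) := by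
    intro D; ext y; simp [neg_lt_iff_pos_add]
  have hfun : ∀ D : ℝ, (fun y : ℝ => (y + D) ^ (ρ / (1 - ρ)) *
      Real.exp (-(1 - ρ) ^ 2 * y ^ 2 / 2)) =
      fun y => psF ((1 - ρ) ^ 2) (ρ / (1 - ρ)) D (y + D) := by
    intro D; ext y; simp [psF]
  have hH : psH ρ = fun D => (1 / Real.sqrt (2 * Real.pi)) *
      psI ((1 - ρ) ^ 2) (ρ / (1 - ρ)) D := by
    ext D
    unfold psH psI
    rw [hfun, ← hpre, (measurePreserving_add_right volume D).setIntegral_preimage_emb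
      (measurableEmbedding_addRight D)]
  have d1 : ∀ D, HasDerivAt (psH ρ) ((1 / Real.sqrt (2 * Real.pi)) * ((1 - ρ) ^ 2 *
      (psI ((1 - ρ) ^ 2) (ρ / (1 - ρ) + 1) D - D * psI ((1 - ρ) ^ 2) (ρ / (1 - ρ)) D))) D := by
    intro D
    rw [hH]
    exact (psI_deriv hc ha D).const_mul _
  have hH' := funext fun D => (d1 D).deriv
  refine ⟨fun D => ?_, fun D => ?_⟩
  · rw [hfun, ← hpre]
    exact ((measurePreserving_add_right volume D).integrableOn_comp_preimage
      (measurableEmbedding_addRight D)).mpr (psF_int hc ha D)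
  · have d2 := ((((psI_deriv hc (by linarith : -1 < ρ / (1 - ρ) + 1) D).sub
      ((hasDerivAt_id D).mul (psI_deriv hc ha D))).const_mul ((1 - ρ) ^ 2)).const_mul
      (1 / Real.sqrt (2 * Real.pi)))
    have d2' := d2.congr_of_eventuallyEq (f₁ := deriv (psH ρ)) (by rw [hH']; exact EventuallyEq.rfl)
    refine ⟨(d1 D).differentiableAt, d2'.differentiableAt, ?_⟩
    rw [d2'.deriv, (d1 D).deriv, hH, psI_rec hc ha D]
    have e : ρ = ρ / (1 - ρ) * (1 - ρ) := by field_simp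
    have e2 : ρ * (1 - ρ) = ρ / (1 - ρ) * (1 - ρ) ^ 2 := by field_simp
    rw [e2]
    simp only [id]
    ring
end

section
/- Fix 0 < ρ < 1 and let 𝓗(Δ) = (1/√(2π)) · ∫_{−Δ}^{∞} (y + Δ)^{ρ/(1−ρ)} · exp(−(1−ρ)²y²/2) dy. Then (i) as Δ → +∞, 𝓗(Δ) is asymptotic to (1/(1−ρ))·Δ^{ρ/(1−ρ)}, i.e. 𝓗(Δ)·(1−ρ)·Δ^{−ρ/(1−ρ)} → 1; and (ii) as Δ → −∞, 𝓗(Δ) is asymptotic to (1/√(2π))·Γ(1/(1−ρ))·(1−ρ)^{−2/(1−ρ)}·(−Δ)^{−1/(1−ρ)}·exp(−(1−ρ)²Δ²/2), i.e. the ratio of 𝓗(Δ) to this expression tends to 1. -/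
open MeasureTheory

open Filter Topology in
theorem psH_aux_top (a c : ℝ) (ha : 0 ≤ a) (hc : 0 < c) :
    Tendsto (fun Δ : ℝ => ∫ y in Set.Ioi (-Δ),
      (1 + y / Δ) ^ a * Real.exp (-c ^ 2 * y ^ 2 / 2)) atTop
      (𝓝 (Real.sqrt (2 * Real.pi) / c)) := by
  have hlim : ∫ y : ℝ, Real.exp (-(c ^ 2 / 2) * y ^ 2) = Real.sqrt (2 * Real.pi) / c := by
    rw [integral_gaussian]
    rw [show Real.pi / (c ^ 2 / 2) = (2 * Real.pi) / c ^ 2 by field_simp,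
      Real.sqrt_div (by positivity), Real.sqrt_sq hc.le]
  rw [← hlim]
  simp_rw [← integral_indicator measurableSet_Ioi]
  refine tendsto_integral_filter_of_dominated_convergence
    (fun y => Real.exp (a ^ 2 / c ^ 2) * Real.exp (-(c ^ 2 / 4) * y ^ 2)) ?_ ?_ ?_ ?_
  · refine Eventually.of_forall fun Δ => ?_
    refine AEStronglyMeasurable.indicator ?_ measurableSet_Ioi
    exact Measurable.aestronglyMeasurable (by fun_prop)
  · filter_upwards [eventually_ge_atTop 1] with Δ hΔ
    refine Eventually.of_forall fun y => ?_
    by_cases hy : y ∈ Set.Ioi (-Δ)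
    · rw [Set.indicator_of_mem hy]
      have hΔ0 : 0 < Δ := by linarith
      have hy' : -Δ < y := hy
      have h0 : 0 ≤ 1 + y / Δ := by
        have : 1 + y / Δ = (Δ + y) / Δ := by field_simp
        rw [this]
        exact div_nonneg (by linarith) hΔ0.le
      have h1 : 1 + y / Δ ≤ Real.exp |y| := by
        have h2 : y / Δ ≤ |y| := by
          rw [div_le_iff₀ hΔ0]
          nlinarith [le_abs_self y, abs_nonneg y]
        linarith [Real.add_one_le_exp |y|]
      have h3 : (1 + y / Δ) ^ a ≤ Real.exp (|y| * a) := by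
        rw [Real.exp_mul]
        exact Real.rpow_le_rpow h0 h1 ha
      rw [Real.norm_of_nonneg (by positivity), ← Real.exp_add]
      calc _ ≤ Real.exp (|y| * a) * Real.exp (-c ^ 2 * y ^ 2 / 2) := by gcongr
        _ ≤ _ := by
          rw [← Real.exp_add]
          apply Real.exp_le_exp.mpr
          have h4 : (c * |y| / 2 - a / c) ^ 2 = c ^ 2 * y ^ 2 / 4 - |y| * a + a ^ 2 / c ^ 2 := by
            rw [← sq_abs y]; field_simp; ring
          nlinarith [sq_nonneg (c * |y| / 2 - a / c)]
    · rw [Set.indicator_of_notMem hy, norm_zero]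
      positivity
  · exact (integrable_exp_neg_mul_sq (by positivity)).const_mul _
  · refine Eventually.of_forall fun y => ?_
    have h1 : Tendsto (fun Δ : ℝ => (1 + y / Δ) ^ a * Real.exp (-c ^ 2 * y ^ 2 / 2)) atTop
        (𝓝 ((1 + 0) ^ a * Real.exp (-c ^ 2 * y ^ 2 / 2))) := by
      refine Tendsto.mul_const _ (Tendsto.rpow_const ?_ (Or.inr ha))
      exact tendsto_const_nhds.add (tendsto_const_nhds.div_atTop tendsto_id)
    have h2 : (1 + 0) ^ a * Real.exp (-c ^ 2 * y ^ 2 / 2) = Real.exp (-(c ^ 2 / 2) * y ^ 2) := by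
      rw [add_zero, Real.one_rpow, one_mul]; congr 1; ring
    rw [h2] at h1
    refine h1.congr' ?_
    filter_upwards [eventually_gt_atTop (-y)] with Δ hΔ
    rw [Set.indicator_of_mem]
    exact show -Δ < y by linarith

open Filter Topology in
theorem psH_aux_bot (a c : ℝ) (ha : 0 ≤ a) (hc : 0 < c) :
    Tendsto (fun D : ℝ => ∫ u in Set.Ioi (0 : ℝ),
      u ^ a * Real.exp (-(c ^ 2 * u)) * Real.exp (-(c ^ 2 * u ^ 2 / 2) / D ^ 2)) atTop
      (𝓝 ((1 / c ^ 2) ^ (a + 1) * Real.Gamma (a + 1))) := by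
  have hlim := Real.integral_rpow_mul_exp_neg_mul_Ioi (a := a + 1) (r := c ^ 2)
    (by linarith) (by positivity)
  rw [add_sub_cancel_right] at hlim
  rw [← hlim]
  refine tendsto_integral_filter_of_dominated_convergence
    (fun u => u ^ a * Real.exp (-(c ^ 2 * u))) ?_ ?_ ?_ ?_
  · exact Eventually.of_forall fun D => Measurable.aestronglyMeasurable (by fun_prop)
  · refine Eventually.of_forall fun D => ?_
    filter_upwards [ae_restrict_mem measurableSet_Ioi] with u hu
    have hu' : 0 < u := hu
    rw [Real.norm_of_nonneg (by positivity)]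
    refine mul_le_of_le_one_right (by positivity) (Real.exp_le_one_iff.mpr ?_)
    rw [neg_div]
    exact neg_nonpos.mpr (by positivity)
  · have := integrableOn_rpow_mul_exp_neg_mul_rpow (p := 1) (s := a) (b := c ^ 2)
      (by linarith) one_pos (by positivity)
    simpa [IntegrableOn] using this
  · refine Eventually.of_forall fun u => ?_
    have h1 : Tendsto (fun D : ℝ => -(c ^ 2 * u ^ 2 / 2) / D ^ 2) atTop (𝓝 0) :=
      tendsto_const_nhds.div_atTop (tendsto_pow_atTop two_ne_zero)
    have h2 := (Real.continuous_exp.tendsto 0).comp h1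
    have h3 := h2.const_mul (u ^ a * Real.exp (-(c ^ 2 * u)))
    simpa [Function.comp_def] using h3

theorem psH_aux_cov (a c D : ℝ) (hD : 0 < D) :
    ∫ y in Set.Ioi D, (y - D) ^ a * Real.exp (-c ^ 2 * y ^ 2 / 2) =
      D ^ (-(a + 1)) * Real.exp (-c ^ 2 * D ^ 2 / 2) *
      ∫ u in Set.Ioi (0 : ℝ),
        u ^ a * Real.exp (-(c ^ 2 * u)) * Real.exp (-(c ^ 2 * u ^ 2 / 2) / D ^ 2) := by
  have h1 : ∫ y in Set.Ioi D, (y - D) ^ a * Real.exp (-c ^ 2 * y ^ 2 / 2) =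
      ∫ v in Set.Ioi (0 : ℝ), v ^ a * Real.exp (-c ^ 2 * (v + D) ^ 2 / 2) := by
    have := (measurePreserving_add_right volume D).setIntegral_preimage_emb
      (MeasurableEquiv.addRight D).measurableEmbedding
      (fun y => (y - D) ^ a * Real.exp (-c ^ 2 * y ^ 2 / 2)) (Set.Ioi D)
    rw [← this]
    simp
  have h2 := integral_comp_mul_left_Ioi
    (fun v : ℝ => v ^ a * Real.exp (-c ^ 2 * (v + D) ^ 2 / 2)) 0 (inv_pos.mpr hD)
  rw [mul_zero, inv_inv, smul_eq_mul] at h2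
  rw [h1, ← mul_right_inj' hD.ne', ← h2, ← integral_const_mul, ← integral_const_mul]
  refine setIntegral_congr_fun measurableSet_Ioi fun u hu => ?_
  have hu' : 0 < u := hu
  have h3 : Real.exp (-c ^ 2 * (D⁻¹ * u + D) ^ 2 / 2) = Real.exp (-c ^ 2 * D ^ 2 / 2) *
      (Real.exp (-(c ^ 2 * u)) * Real.exp (-(c ^ 2 * u ^ 2 / 2) / D ^ 2)) := by
    rw [← Real.exp_add, ← Real.exp_add]
    congr 1
    field_simp
    ring
  have h4 : (D⁻¹ * u) ^ a = D * D ^ (-(a + 1)) * u ^ a := by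
    rw [Real.mul_rpow (by positivity) hu'.le, Real.inv_rpow hD.le, ← Real.rpow_neg hD.le]
    congr 1
    have h5 : D * D ^ (-(a + 1)) = D ^ (1 : ℝ) * D ^ (-(a + 1)) := by rw [Real.rpow_one]
    rw [h5, ← Real.rpow_add hD]
    congr 1
    ring
  simp only [h3, h4]
  ring

/-- asymptotics of `𝓗`:
as `Δ → +∞`, `𝓗(Δ) ∼ (1/(1-ρ)) Δ^{ρ/(1-ρ)}`, and as `Δ → -∞`,
`𝓗(Δ) ∼ (1/√(2π)) Γ(1/(1-ρ)) (1-ρ)^{-2/(1-ρ)} (-Δ)^{-1/(1-ρ)} e^{-(1-ρ)²Δ²/2}`. -/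
theorem psH_asymptotics (ρ : ℝ) (h0 : 0 < ρ) (h1 : ρ < 1) :
    Filter.Tendsto (fun Δ : ℝ => psH ρ Δ * (1 - ρ) * Δ ^ (-(ρ / (1 - ρ))))
      Filter.atTop (nhds 1) ∧
    Filter.Tendsto (fun Δ : ℝ => psH ρ Δ /
        ((1 / Real.sqrt (2 * Real.pi)) * Real.Gamma (1 / (1 - ρ)) *
          (1 - ρ) ^ (-2 / (1 - ρ)) * (-Δ) ^ (-1 / (1 - ρ)) *
          Real.exp (-(1 - ρ) ^ 2 * Δ ^ 2 / 2)))
      Filter.atBot (nhds 1) := by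
  have hc : 0 < 1 - ρ := by linarith
  have ha : 0 ≤ ρ / (1 - ρ) := by positivity
  have ha1 : ρ / (1 - ρ) + 1 = 1 / (1 - ρ) := by field_simp; ring
  have hs : 0 < Real.sqrt (2 * Real.pi) := by positivity
  constructor
  · have h := (psH_aux_top (ρ / (1 - ρ)) (1 - ρ) ha hc).const_mul
      ((1 - ρ) / Real.sqrt (2 * Real.pi))
    rw [show (1 - ρ) / Real.sqrt (2 * Real.pi) * (Real.sqrt (2 * Real.pi) / (1 - ρ)) = 1 by
      field_simp] at h
    refine h.congr' ?_
    filter_upwards [Filter.eventually_gt_atTop 0] with Δ hΔ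
    have h2 : ∫ y in Set.Ioi (-Δ),
        (y + Δ) ^ (ρ / (1 - ρ)) * Real.exp (-(1 - ρ) ^ 2 * y ^ 2 / 2) =
        Δ ^ (ρ / (1 - ρ)) * ∫ y in Set.Ioi (-Δ),
        (1 + y / Δ) ^ (ρ / (1 - ρ)) * Real.exp (-(1 - ρ) ^ 2 * y ^ 2 / 2) := by
      rw [← integral_const_mul]
      refine setIntegral_congr_fun measurableSet_Ioi fun y hy => ?_
      have hy' : -Δ < y := hy
      have h3 : y + Δ = Δ * (1 + y / Δ) := by field_simp; ring
      have h4 : 0 ≤ 1 + y / Δ := by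
        by_contra hneg
        push Not at hneg
        nlinarith
      rw [h3, Real.mul_rpow hΔ.le h4]
      ring
    have h5 : Δ ^ (ρ / (1 - ρ)) * Δ ^ (-(ρ / (1 - ρ))) = 1 := by
      rw [← Real.rpow_add hΔ]; simp
    rw [psH, h2]
    linear_combination (-(1 - ρ) / Real.sqrt (2 * Real.pi) * ∫ y in Set.Ioi (-Δ),
        (1 + y / Δ) ^ (ρ / (1 - ρ)) * Real.exp (-(1 - ρ) ^ 2 * y ^ 2 / 2)) * h5
  · have h := (psH_aux_bot (ρ / (1 - ρ)) (1 - ρ) ha hc).comp Filter.tendsto_neg_atBot_atTop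
    have hK : (1 / (1 - ρ) ^ 2) ^ (ρ / (1 - ρ) + 1) * Real.Gamma (ρ / (1 - ρ) + 1) =
        Real.Gamma (1 / (1 - ρ)) * (1 - ρ) ^ (-2 / (1 - ρ)) := by
      rw [ha1, mul_comm]
      congr 1
      rw [one_div, ← Real.rpow_natCast, ← Real.rpow_neg hc.le, ← Real.rpow_mul hc.le]
      congr 1
      push_cast
      ring
    rw [hK] at h
    have hG : 0 < Real.Gamma (1 / (1 - ρ)) := Real.Gamma_pos_of_pos (by positivity)
    have hp : 0 < (1 - ρ) ^ (-2 / (1 - ρ)) := Real.rpow_pos_of_pos hc _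
    have h' := h.div_const (Real.Gamma (1 / (1 - ρ)) * (1 - ρ) ^ (-2 / (1 - ρ)))
    rw [div_self (by positivity)] at h'
    refine h'.congr' ?_
    filter_upwards [Filter.eventually_lt_atBot 0] with Δ hΔ
    have hD : 0 < -Δ := by linarith
    have hcov := psH_aux_cov (ρ / (1 - ρ)) (1 - ρ) (-Δ) hD
    have hDp : 0 < (-Δ) ^ (-1 / (1 - ρ)) := Real.rpow_pos_of_pos hD _
    rw [ha1, ← neg_div] at hcov
    simp only [sub_neg_eq_add] at hcov
    rw [psH, hcov, neg_sq Δ, Function.comp_apply]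
    simp only [neg_sq Δ]
    have he := Real.exp_pos (-(1 - ρ) ^ 2 * Δ ^ 2 / 2)
    field_simp
end
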